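/- arXiv:2507.11221 — 2 statements merged into one kernel-verified Lean document; each statement's English description precedes it below -/
import Mathlib

section
/- Let R be a ring and let M be an R-module. If there exists an R-module E that is both injective and projective together with an injective R-linear map M → E (i.e., M is a submodule of a module that is both injective and projective), then M is subinjective extension-reflecting (si.e.r.). -/
universe u

/-- `IsSubinjective R B A` means: the `R`-module `B` is `A`-subinjective, i.e. for every
`R`-module `C`, every injective `R`-linear map `i : A → C` and every `R`-linear map
`f : A → B`, there is an `R`-linear map `g : C → B` with `g ∘ i = f`. -/
def IsSubinjective (R : Type u) [Ring R] (B : Type u) [AddCommGroup B] [Module R B]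
    (A : Type u) [AddCommGroup A] [Module R A] : Prop :=
  ∀ (C : Type u) [AddCommGroup C] [Module R C] (i : A →ₗ[R] C),
    Function.Injective i → ∀ f : A →ₗ[R] B, ∃ g : C →ₗ[R] B, g ∘ₗ i = f

/-- `IsSubprojective R B A` means: the `R`-module `B` is `A`-subprojective, i.e. for every
`R`-module `C`, every surjective `R`-linear map `g : C → A` and every `R`-linear map
`f : B → A`, there is an `R`-linear map `h : B → C` with `g ∘ h = f`. -/
def IsSubprojective (R : Type u) [Ring R] (B : Type u) [AddCommGroup B] [Module R B]
    (A : Type u) [AddCommGroup A] [Module R A] : Prop :=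
  ∀ (C : Type u) [AddCommGroup C] [Module R C] (g : C →ₗ[R] A),
    Function.Surjective g → ∀ f : B →ₗ[R] A, ∃ h : B →ₗ[R] C, g ∘ₗ h = f

/-- `M` is subinjective extension-reflecting (si.e.r.): for every short exact sequence
`0 → A → B → C → 0`, if `A` and `C` are `M`-subinjective, then so is `B`. -/
def IsSIER (R : Type u) [Ring R] (M : Type u) [AddCommGroup M] [Module R M] : Prop :=
  ∀ (A B C : Type u) [AddCommGroup A] [Module R A] [AddCommGroup B] [Module R B]
    [AddCommGroup C] [Module R C] (f : A →ₗ[R] B) (g : B →ₗ[R] C),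
    Function.Injective f → Function.Surjective g → Function.Exact f g →
    IsSubinjective R A M → IsSubinjective R C M → IsSubinjective R B M

/-- `M` is subprojective extension-reflecting (sp.e.r.): for every short exact sequence
`0 → A → B → C → 0`, if `A` and `C` are `M`-subprojective, then so is `B`. -/
def IsSPER (R : Type u) [Ring R] (M : Type u) [AddCommGroup M] [Module R M] : Prop :=
  ∀ (A B C : Type u) [AddCommGroup A] [Module R A] [AddCommGroup B] [Module R B]
    [AddCommGroup C] [Module R C] (f : A →ₗ[R] B) (g : B →ₗ[R] C),
    Function.Injective f → Function.Surjective g → Function.Exact f g →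
    IsSubprojective R A M → IsSubprojective R C M → IsSubprojective R B M

/-- If `M` is a submodule of a module `E` that is both injective and projective, then `M` is
si.e.r. -/
theorem submodule_of_injective_projective_isSIER (R : Type u) [Ring R]
    (M : Type u) [AddCommGroup M] [Module R M]
    (E : Type u) [AddCommGroup E] [Module R E]
    (hEinj : Module.Injective R E) (hEproj : Module.Projective R E)
    (i : M →ₗ[R] E) (hi : Function.Injective i) :
    IsSIER R M := by
  intro A B C _ _ _ _ _ _ f g hf hg hfg hA hC X _ _ j hj φ
  obtain ⟨h, hh⟩ := hC E i hi (g ∘ₗ φ)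
  obtain ⟨k, hk⟩ := Module.projective_lifting_property g h hg
  have hmem : ∀ m, (φ - k ∘ₗ i) m ∈ LinearMap.range f := by
    intro m
    apply (hfg _).1
    have h1 := LinearMap.congr_fun hh m
    have h2 := LinearMap.congr_fun hk (i m)
    simp only [LinearMap.comp_apply] at h1 h2
    simp [h2, h1]
  obtain ⟨a, ha⟩ := hA E i hi
    ((LinearEquiv.ofInjective f hf).symm.toLinearMap ∘ₗ
      (φ - k ∘ₗ i).codRestrict (LinearMap.range f) hmem)
  obtain ⟨e, he⟩ := hEinj.out j hj i
  refine ⟨(k + f ∘ₗ a) ∘ₗ e, ?_⟩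
  ext m
  have h3 : a (i m) = (LinearEquiv.ofInjective f hf).symm ⟨(φ - k ∘ₗ i) m, hmem m⟩ :=
    LinearMap.congr_fun ha m
  have h4 : f (a (i m)) = (φ - k ∘ₗ i) m := by
    rw [h3, ← LinearEquiv.ofInjective_apply (h := hf), LinearEquiv.apply_symm_apply]
  simp [he, h4]
end

section
/- Let R be a quasi-Frobenius ring, i.e., a Noetherian ring that is injective as a module over itself. Then every R-module is subinjective extension-reflecting (si.e.r.) and every R-module is subprojective extension-reflecting (sp.e.r.). -/
universe u

section QFaux
variable {R : Type u} [Ring R]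

theorem qf_ext (hR : Module.Injective R R) {M N : Type u} [AddCommGroup M] [Module R M]
    [AddCommGroup N] [Module R N] (φ : M →ₗ[R] N) (ψ : M →ₗ[R] R)
    (h : ∀ x, φ x = 0 → ψ x = 0) : ∃ g : N →ₗ[R] R, ∀ x, g (φ x) = ψ x := by
  have hle : LinearMap.ker φ ≤ LinearMap.ker ψ := fun x hx => h x hx
  obtain ⟨g, hg⟩ := hR.out ((LinearMap.ker φ).liftQ φ le_rfl)
    (LinearMap.ker_eq_bot.mp (Submodule.ker_liftQ_eq_bot _ _ _ le_rfl))
    ((LinearMap.ker φ).liftQ ψ hle)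
  exact ⟨g, fun x => by simpa using hg (Submodule.Quotient.mk x)⟩

theorem qf_finsupp_injective [IsNoetherianRing R] (hR : Module.Injective R R) (ι : Type u) :
    Module.Injective R (ι →₀ R) := by
  classical
  apply Module.Baer.injective
  intro I g
  have hB := Module.Baer.of_injective hR
  choose b hb using fun i => hB I (Finsupp.lapply i ∘ₗ g)
  obtain ⟨s, hs⟩ : (⊤ : Submodule R I).FG := Module.Finite.fg_top
  let F : Finset ι := s.biUnion fun x => (g x).support
  have hF : ∀ x, g x ∈ Finsupp.supported R R (F : Set ι) := by
    intro x
    have : (⊤ : Submodule R I) ≤ (Finsupp.supported R R (F : Set ι)).comap g := by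
      rw [← hs, Submodule.span_le]
      intro y hy
      simp only [Submodule.comap_coe, Set.mem_preimage, SetLike.mem_coe, Finsupp.mem_supported]
      intro i hi
      exact Finset.mem_biUnion.mpr ⟨y, hy, hi⟩
    exact this trivial
  refine ⟨∑ i ∈ F, (Finsupp.lsingle i) ∘ₗ b i, ?_⟩
  intro x hx
  ext i
  have h1 := hb i x hx
  simp only [LinearMap.coe_comp, Function.comp_apply, Finsupp.lapply_apply] at h1
  simp only [LinearMap.sum_apply, LinearMap.coe_comp, Function.comp_apply,
    Finsupp.lsingle_apply, Finsupp.finsetSum_apply, Finsupp.single_apply]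
  rw [Finset.sum_ite_eq']
  split_ifs with hi
  · exact h1
  · symm
    have := hF ⟨x, hx⟩
    rw [Finsupp.mem_supported'] at this
    exact this i hi

theorem qf_regular_semisimple {S : Type u} [Ring S] [IsNoetherianRing S]
    (h : ∀ a : S, ∃ b, a * b * a = a) : IsSemisimpleRing S := by
  suffices H : ComplementedLattice (Submodule S S) from
    (isSemisimpleModule_iff S S).mpr H
  refine ⟨fun (I : Ideal S) => ?_⟩
  let P : Set (Ideal S) := {K | ∃ e ∈ I, e * e = e ∧ K = Ideal.span {e}}
  obtain ⟨K, ⟨e, heI, he, rfl⟩, hmax⟩ := set_has_maximal_iff_noetherian.mpr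
    (inferInstance : IsNoetherian S S) P ⟨_, 0, I.zero_mem, by simp, rfl⟩
  have hI : ∀ x ∈ I, x * e = x := by
    intro x hx
    by_contra hne
    set y := x - x * e with hy
    have hyI : y ∈ I := I.sub_mem hx (I.mul_mem_left _ heI)
    have hye : y * e = 0 := by rw [hy, sub_mul, mul_assoc, he, sub_self]
    have hy0 : y ≠ 0 := fun h0 => hne (sub_eq_zero.mp h0).symm
    obtain ⟨z, hz⟩ := h y
    obtain ⟨f, hf⟩ : ∃ f, f = z * y := ⟨_, rfl⟩
    have hfI : f ∈ I := hf ▸ I.mul_mem_left _ hyI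
    have hff : f * f = f := by
      rw [hf, mul_assoc, ← mul_assoc y, hz]
    have hfe : f * e = 0 := by rw [hf, mul_assoc, hye, mul_zero]
    have hf0 : f ≠ 0 := fun h0 => hy0 (by rw [← hz, mul_assoc, ← hf, h0, mul_zero])
    set g := e + f - e * f with hg
    have heg : e * g = e := by
      rw [hg, mul_sub, mul_add, ← mul_assoc, he]; simp
    have hfg : f * g = f := by
      rw [hg, mul_sub, mul_add, ← mul_assoc, hfe, hff]; simp
    have hgg : g * g = g := by
      conv_lhs => rw [hg]
      rw [sub_mul, add_mul, mul_assoc e f g, heg, hfg]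
    refine hmax (Ideal.span {g}) ⟨g, ?_, hgg, rfl⟩ ?_
    · exact I.sub_mem (I.add_mem heI hfI) (I.mul_mem_left _ hfI)
    · refine lt_of_le_of_ne ?_ ?_
      · rw [Ideal.span_singleton_le_iff_mem, Ideal.mem_span_singleton']
        exact ⟨e, heg⟩
      · intro heq
        have : f ∈ Ideal.span {e} := by
          rw [heq, Ideal.mem_span_singleton']; exact ⟨f, hfg⟩
        obtain ⟨c, hc⟩ := Ideal.mem_span_singleton'.mp this
        apply hf0
        rw [← hfe, ← hc, mul_assoc, he]
  refine ⟨Ideal.span {1 - e}, ?_⟩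
  constructor
  · rw [Submodule.disjoint_def]
    intro x hx hx'
    obtain ⟨c, hc⟩ := Ideal.mem_span_singleton'.mp hx'
    rw [← hI x hx, ← hc, mul_assoc, sub_mul, he]; simp
  · rw [codisjoint_iff, eq_top_iff]
    intro x _
    rw [show x = x * e + x * (1 - e) by rw [mul_sub]; simp]
    exact Submodule.add_mem_sup (I.mul_mem_left _ heI)
      (Ideal.mem_span_singleton'.mpr ⟨x, rfl⟩)

/-- The left singular ideal. -/
def qfZ (R : Type u) [Ring R] : Ideal R where
  carrier := {z | ∀ x : R, x ≠ 0 → ∃ r : R, r * x ≠ 0 ∧ r * x * z = 0}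
  zero_mem' := fun x hx => ⟨1, by simpa using hx, by simp⟩
  add_mem' := by
    intro z w hz hw x hx
    obtain ⟨r, h1, h2⟩ := hz x hx
    obtain ⟨s, h3, h4⟩ := hw _ h1
    refine ⟨s * r, by rwa [mul_assoc], ?_⟩
    rw [mul_add, mul_assoc s r x, h4, mul_assoc, h2]; simp
  smul_mem' := by
    intro c z hz x hx
    by_cases hxc : x * c = 0
    · refine ⟨1, by simpa using hx, ?_⟩
      rw [smul_eq_mul, one_mul, ← mul_assoc, hxc, zero_mul]
    · obtain ⟨r, h1, h2⟩ := hz _ hxc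
      refine ⟨r, fun h0 => h1 ?_, ?_⟩
      · rw [← mul_assoc, h0, zero_mul]
      · rw [← h2]; simp [mul_assoc]

theorem mem_qfZ {z : R} :
    z ∈ qfZ R ↔ ∀ x : R, x ≠ 0 → ∃ r : R, r * x ≠ 0 ∧ r * x * z = 0 := Iff.rfl

instance qfZ_twoSided : (qfZ R).IsTwoSided where
  mul_mem_of_left := by
    intro z c hz x hx
    obtain ⟨r, h1, h2⟩ := hz x hx
    exact ⟨r, h1, by rw [← mul_assoc, h2, zero_mul]⟩

/-- left annihilator -/
def qfL (X : Set R) : Ideal R where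
  carrier := {a | ∀ x ∈ X, a * x = 0}
  zero_mem' := by intro x _; simp
  add_mem' := by
    intro a b ha hb x hx
    rw [add_mul, ha x hx, hb x hx, add_zero]
  smul_mem' := by
    intro c a ha x hx
    rw [smul_eq_mul, mul_assoc, ha x hx, mul_zero]

theorem mem_qfL {X : Set R} {a : R} : a ∈ qfL X ↔ ∀ x ∈ X, a * x = 0 := Iff.rfl

theorem qfZ_nilpotent [IsNoetherianRing R] : IsNilpotent (qfZ R) := by
  let L : ℕ →o Ideal R :=
    { toFun := fun n => qfL ((qfZ R ^ n : Ideal R) : Set R)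
      monotone' := by
        intro m n hmn a ha x hx
        exact ha x (Ideal.pow_le_pow_right hmn hx) }
  obtain ⟨n, hn⟩ := monotone_stabilizes_iff_noetherian.mpr
    (inferInstance : IsNoetherian R R) L
  obtain ⟨n, hn0, hn1⟩ : ∃ n, n ≠ 0 ∧ L n = L (n + 1) :=
    ⟨n + 1, by simp, (hn (n + 1) (by omega)).symm.trans (hn (n + 2) (by omega))⟩
  have key : ∀ a ∈ qfZ R, a ∈ L n := by
    by_contra! hcon
    obtain ⟨a0, ha0, ha0n⟩ := hcon
    let P : Set (Ideal R) := {K | ∃ a ∈ qfZ R, a ∉ L n ∧ K = qfL {a}}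
    obtain ⟨K, ⟨a, haZ, han, rfl⟩, hmax⟩ := set_has_maximal_iff_noetherian.mpr
      (inferInstance : IsNoetherian R R) P ⟨_, a0, ha0, ha0n, rfl⟩
    apply han
    rw [hn1]
    have hab : ∀ b ∈ qfZ R, a * b ∈ L n := by
      intro b hb
      by_contra hnot
      have ha : a ≠ 0 := by rintro rfl; exact han (L n).zero_mem
      obtain ⟨r, h1, h2⟩ := hb a ha
      refine hmax _ ⟨a * b, (qfZ R).mul_mem_left _ hb, hnot, rfl⟩ ?_
      refine lt_of_le_of_ne ?_ ?_
      · intro c hc x hx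
        rw [Set.mem_singleton_iff] at hx
        rw [hx, ← mul_assoc, hc a rfl, zero_mul]
      · intro heq
        have : r ∈ qfL {a} := by
          rw [heq]; intro x hx
          rw [Set.mem_singleton_iff] at hx
          rw [hx, ← mul_assoc, h2]
        exact h1 (this a rfl)
    intro x hx
    replace hx : x ∈ qfZ R ^ (n + 1) := hx
    rw [Submodule.pow_succ' _ hn0] at hx
    refine Submodule.mul_induction_on hx ?_ ?_
    · intro b hb c hc
      rw [← mul_assoc]
      exact hab b hb c hc
    · intro x y hx hy
      rw [mul_add, hx, hy, add_zero]
  refine ⟨n + 1, ?_⟩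
  rw [Submodule.pow_succ' _ hn0, Submodule.zero_eq_bot, eq_bot_iff, Ideal.mul_le]
  intro b hb c hc
  exact key b hb c hc

theorem qf_regular [IsNoetherianRing R] (hR : Module.Injective R R) (a : R) :
    ∃ b, a * b * a - a ∈ qfZ R := by
  let P : Set (Ideal R) := {K | Disjoint (qfL {a}) K}
  obtain ⟨K, hK, hmax⟩ := set_has_maximal_iff_noetherian.mpr
    (inferInstance : IsNoetherian R R) P ⟨⊥, disjoint_bot_right⟩
  have hK' : Disjoint (qfL {a}) K := hK
  have hess : ∀ x : R, x ≠ 0 → ∃ r : R, r * x ≠ 0 ∧ r * x ∈ qfL {a} ⊔ K := by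
    intro x hx
    by_contra! hno
    have hd : Disjoint (qfL {a} ⊔ K) (Ideal.span {x}) := by
      rw [Submodule.disjoint_def]
      intro y hy hy'
      obtain ⟨r, rfl⟩ := Ideal.mem_span_singleton'.mp hy'
      by_contra h0
      exact hno r h0 hy
    have h2 : Disjoint (qfL {a}) (K ⊔ Ideal.span {x}) :=
      hK'.disjoint_sup_right_of_disjoint_sup_left hd
    have h3 := hmax _ h2
    have hxK : x ∈ K := by
      by_contra hxK
      apply h3
      refine lt_of_le_of_ne le_sup_left fun heq => hxK ?_
      rw [heq]
      exact (le_sup_right : Ideal.span {x} ≤ _) (Ideal.mem_span_singleton_self x)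
    exact hx (Submodule.disjoint_def.mp hd x ((le_sup_right : K ≤ _) hxK)
      (Ideal.mem_span_singleton_self x))
  obtain ⟨g, hg⟩ := qf_ext hR (LinearMap.toSpanSingleton R R a ∘ₗ K.subtype) K.subtype (by
    intro x hx
    refine Submodule.disjoint_def.mp hK' _ ?_ x.2
    intro y hy
    rw [Set.mem_singleton_iff] at hy
    simpa [hy] using hx)
  have hg' : ∀ k ∈ K, k * a * g 1 = k := by
    intro k hk
    have := hg ⟨k, hk⟩
    simp only [LinearMap.coe_comp, Function.comp_apply, Submodule.subtype_apply,
      LinearMap.toSpanSingleton_apply, smul_eq_mul] at this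
    rw [← this]
    conv_rhs => rw [this, ← this]
    rw [this]
    rw [← smul_eq_mul (k * a), ← map_smul, smul_eq_mul, mul_one, this]
  refine ⟨g 1, ?_⟩
  intro x hx
  obtain ⟨r, h1, h2⟩ := hess x hx
  refine ⟨r, h1, ?_⟩
  obtain ⟨l, hl, k, hk, hlk⟩ := Submodule.mem_sup.mp h2
  have hla : l * a = 0 := hl a rfl
  rw [← hlk, add_mul, mul_sub, mul_sub, ← mul_assoc, ← mul_assoc, ← mul_assoc, ← mul_assoc,
    hg' k hk, hla]
  simp

theorem qf_semisimpleZ [IsNoetherianRing R] (hR : Module.Injective R R) :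
    IsSemisimpleRing (R ⧸ qfZ R) := by
  have : IsNoetherianRing (R ⧸ qfZ R) :=
    isNoetherianRing_of_surjective _ _ (Ideal.Quotient.mk (qfZ R)) Ideal.Quotient.mk_surjective
  apply qf_regular_semisimple
  intro a
  obtain ⟨a, rfl⟩ := Ideal.Quotient.mk_surjective a
  obtain ⟨b, hb⟩ := qf_regular hR a
  refine ⟨Ideal.Quotient.mk _ b, ?_⟩
  rw [← map_mul, ← map_mul]
  exact Ideal.Quotient.eq.mpr hb

theorem qf_jacobson [IsNoetherianRing R] (hR : Module.Injective R R) :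
    Ring.jacobson R = qfZ R := by
  have := qf_semisimpleZ hR
  apply le_antisymm
  · exact Ring.jacobson_le_of_eq_bot (IsSemisimpleRing.jacobson_eq_bot _)
  · obtain ⟨n, hn⟩ := qfZ_nilpotent (R := R)
    rw [Ring.jacobson_eq_sInf_isMaximal]
    refine le_sInf fun m hm => ?_
    have hm : m.IsMaximal := hm
    by_contra hle
    have htop : m ⊔ qfZ R = ⊤ := hm.out.2 _ (left_lt_sup.mpr hle)
    obtain ⟨a, ha, z, hz, haz⟩ := Submodule.mem_sup.mp
      (show (1 : R) ∈ m ⊔ qfZ R by rw [htop]; trivial)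
    have hzn : IsNilpotent z := ⟨n, by
      have := Ideal.pow_mem_pow hz n
      rw [hn] at this
      simpa using this⟩
    have hu := hzn.isUnit_one_sub
    rw [← haz, add_sub_cancel_right] at hu
    exact hm.ne_top (Ideal.eq_top_of_isUnit_mem _ ha hu)

theorem qf_semiprimary [IsNoetherianRing R] (hR : Module.Injective R R) :
    IsSemiprimaryRing R := by
  have h := qf_jacobson hR
  refine ⟨?_, ?_⟩
  · have h2 := qf_semisimpleZ hR
    exact (Ideal.quotEquivOfEq h.symm).isSemisimpleRing
  · rw [h]; exact qfZ_nilpotent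


theorem qf_rl [IsArtinianRing R] (hR : Module.Injective R R) (W : Set R) (h0 : (0 : R) ∈ W)
    (hadd : ∀ x ∈ W, ∀ y ∈ W, x + y ∈ W) (hmul : ∀ x ∈ W, ∀ r : R, x * r ∈ W)
    (x : R) (hx : ∀ a ∈ qfL W, a * x = 0) : x ∈ W := by
  classical
  let P : Set (Ideal R) := {K | ∃ F : Finset R, (F : Set R) ⊆ W ∧ K = qfL (F : Set R)}
  obtain ⟨K, ⟨F, hFW, rfl⟩, hmin⟩ := IsArtinian.set_has_minimal P ⟨_, ∅, by simp, rfl⟩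
  have hF : qfL (F : Set R) ≤ qfL W := by
    intro a ha w hw
    by_contra hne
    refine hmin (qfL ((insert w F : Finset R) : Set R)) ⟨insert w F, ?_, rfl⟩ ?_
    · intro y hy
      rcases Finset.mem_insert.mp hy with rfl | hy
      · exact hw
      · exact hFW hy
    · refine lt_of_le_of_ne ?_ ?_
      · intro b hb y hy
        exact hb y (Finset.mem_insert_of_mem hy)
      · intro heq
        rw [← heq] at ha
        exact hne (ha w (Finset.mem_insert_self w F))
  obtain ⟨g, hg⟩ := qf_ext hR
    (LinearMap.pi fun w : F => LinearMap.toSpanSingleton R R w.1)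
    (LinearMap.toSpanSingleton R R x) (by
      intro a ha
      have : a ∈ qfL (F : Set R) := by
        intro w hw
        have := congrFun ha ⟨w, hw⟩
        simpa using this
      simpa using hx a (hF this))
  have h1 := hg 1
  rw [LinearMap.pi_apply_eq_sum_univ] at h1
  simp only [LinearMap.pi_apply, LinearMap.toSpanSingleton_apply, smul_eq_mul,
    one_mul] at h1
  rw [← h1]
  have hs : ∀ (s : Finset F) (c : F → R), ∑ i ∈ s, i.1 * c i ∈ W := by
    intro s c
    induction s using Finset.induction_on with
    | empty => simpa using h0
    | insert a s ha ih =>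
      rw [Finset.sum_insert ha]
      exact hadd _ (hmul _ (hFW a.2) _) _ ih
  exact hs _ _

theorem qf_inf (hR : Module.Injective R R) (A B : Ideal R) (y : R)
    (hy : ∀ a ∈ A ⊓ B, a * y = 0) :
    ∃ c, (∀ a ∈ A, a * (y - c) = 0) ∧ (∀ b ∈ B, b * c = 0) := by
  obtain ⟨g, hg⟩ := qf_ext hR (LinearMap.coprod A.subtype B.subtype)
    (LinearMap.toSpanSingleton R R y ∘ₗ A.subtype ∘ₗ LinearMap.fst R A B) (by
      rintro ⟨a, b⟩ hab
      simp only [LinearMap.coprod_apply, Submodule.subtype_apply] at hab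
      have : (a : R) ∈ B := by
        rw [eq_neg_of_add_eq_zero_left hab]; exact B.neg_mem b.2
      simpa using hy a ⟨a.2, this⟩)
  have hg1 : ∀ r, g r = r * g 1 := fun r => by
    rw [← smul_eq_mul, ← map_smul, smul_eq_mul, mul_one]
  refine ⟨g 1, ?_, ?_⟩
  · intro a ha
    have := hg (⟨a, ha⟩, 0)
    simp at this
    rw [mul_sub, ← hg1, this, sub_self]
  · intro b hb
    have := hg (0, ⟨b, hb⟩)
    simp at this
    rw [← hg1, this]

/-- elements killed on the left by the Jacobson radical -/
def qfT (R : Type u) [Ring R] : Ideal R where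
  carrier := {t | ∀ j ∈ Ring.jacobson R, j * t = 0}
  zero_mem' := by intro j _; simp
  add_mem' := by
    intro a b ha hb j hj
    rw [mul_add, ha j hj, hb j hj, add_zero]
  smul_mem' := by
    intro c a ha j hj
    rw [smul_eq_mul, ← mul_assoc]
    exact ha _ (Ideal.mul_mem_right _ _ hj)

theorem qf_T_essential [IsSemiprimaryRing R] (x : R) (hx : x ≠ 0) :
    ∃ r : R, r * x ≠ 0 ∧ r * x ∈ qfT R := by
  obtain ⟨n, hn⟩ := IsSemiprimaryRing.isNilpotent (R := R)
  have key : ∀ n : ℕ, ∀ x : R, x ≠ 0 → (∀ a ∈ Ring.jacobson R ^ n, a * x = 0) →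
      ∃ r : R, r * x ≠ 0 ∧ r * x ∈ qfT R := by
    intro n
    induction n with
    | zero =>
      intro x hx h
      exact absurd (by simpa using h 1 (by simp [Submodule.pow_zero])) hx
    | succ n ih =>
      intro x hx h
      by_cases hT : x ∈ qfT R
      · exact ⟨1, by simpa using hx, by simpa using hT⟩
      · have hT' : ¬ ∀ j ∈ Ring.jacobson R, j * x = 0 := hT
        push Not at hT'
        obtain ⟨j, hj, hjx⟩ := hT'
        obtain ⟨r, h1, h2⟩ := ih (j * x) hjx (by
          intro a ha
          rw [← mul_assoc]
          refine h _ ?_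
          rw [Submodule.pow_succ]
          exact Submodule.mul_mem_mul ha hj)
        exact ⟨r * j, by rwa [mul_assoc], by rwa [mul_assoc]⟩
  exact key n x hx (by
    intro a ha
    rw [hn] at ha
    rw [(Submodule.mem_bot R).mp ha, zero_mul])

/-- Two-sided ideals above the Jacobson radical. -/
def QFX (R : Type u) [Ring R] : Type u :=
  {K : Ideal R // K.IsTwoSided ∧ Ring.jacobson R ≤ K}

theorem qfX_finite [IsSemiprimaryRing R] : Finite (QFX R) := by
  let S := R ⧸ Ring.jacobson R
  have : Finite (fullyInvariantSubmodule S S) :=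
    Finite.of_equiv _ (OrderIso.setIsotypicComponents (R := S) (M := S)).toEquiv
  let F : QFX R → fullyInvariantSubmodule S S := fun K =>
    ⟨Ideal.map (Ideal.Quotient.mk (Ring.jacobson R)) K.1, by
      rw [mem_fullyInvariantSubmodule_iff, isFullyInvariant_iff_isTwoSided]
      have := K.2.1
      refine ⟨?_⟩
      intro a b ha
      obtain ⟨b, rfl⟩ := Ideal.Quotient.mk_surjective b
      obtain ⟨a, haK, rfl⟩ := (Ideal.mem_map_iff_of_surjective _
        Ideal.Quotient.mk_surjective).mp ha
      rw [← map_mul]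
      exact Ideal.mem_map_of_mem _ (Ideal.mul_mem_right _ _ haK)⟩
  refine Finite.of_injective F ?_
  have key : ∀ K : QFX R, ∀ x : R, x ∈ K.1 ↔
      Ideal.Quotient.mk (Ring.jacobson R) x ∈ (F K).1 := by
    intro K x
    refine ⟨fun h => Ideal.mem_map_of_mem _ h, fun h => ?_⟩
    obtain ⟨a, haK, ha⟩ := (Ideal.mem_map_iff_of_surjective _
        Ideal.Quotient.mk_surjective).mp h
    have h1 := K.2.2 (Ideal.Quotient.eq.mp ha)
    have := K.1.sub_mem haK h1
    simpa using this
  intro K K' h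
  apply Subtype.ext
  ext x
  rw [key, key, h]

/-- the finite map -/
def qfW (K : Ideal R) : Ideal R := qfT R ⊓ qfL (K : Set R)

theorem qfW_mul_mem (K : Ideal R) [K.IsTwoSided] (x : R) (hx : x ∈ qfW K) (r : R) :
    x * r ∈ qfW K := by
  refine ⟨?_, ?_⟩
  · intro j hj
    rw [← mul_assoc, hx.1 j hj, zero_mul]
  · intro k hk
    rw [mul_assoc]
    exact hx.2 _ (K.mul_mem_left _ hk)

theorem qf_recover [IsNoetherianRing R] [IsArtinianRing R] [IsSemiprimaryRing R]
    (hR : Module.Injective R R)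
    (K : QFX R) (y : R) : y ∈ K.1 ↔ ∀ w ∈ qfW K.1, w * y = 0 := by
  have := K.2.1
  constructor
  · intro hy w hw
    exact hw.2 y hy
  · intro h
    obtain ⟨c, h1, h2⟩ := qf_inf hR _ _ y h
    have hc : c ∈ K.1 := qf_rl hR (K.1 : Set R) K.1.zero_mem
      (fun x hx y hy => K.1.add_mem hx hy) (fun x hx r => Ideal.mul_mem_right _ _ hx) c h2
    have hyc : y - c ∈ K.1 := by
      apply K.2.2
      rw [qf_jacobson hR]
      intro x hx
      obtain ⟨r, h3, h4⟩ := qf_T_essential x hx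
      exact ⟨r, h3, h1 _ h4⟩
    simpa using K.1.add_mem hyc hc

theorem qf_two_sided_ann [IsNoetherianRing R] [IsArtinianRing R] [IsSemiprimaryRing R]
    (hR : Module.Injective R R) (I : Ideal R) (hI : I.IsTwoSided)
    (hJ : Ring.jacobson R ≤ I) (htop : I ≠ ⊤) : ∃ w : R, w ≠ 0 ∧ ∀ a ∈ I, a * w = 0 := by
  let Ψ : QFX R → QFX R := fun K => ⟨qfL (qfW K.1 : Set R), by
    have := K.2.1
    refine ⟨⟨?_⟩, ?_⟩
    · intro a b ha w hw
      rw [mul_assoc]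
      exact ha _ ((qfW K.1).mul_mem_left _ hw)
    · intro j hj w hw
      exact hw.1 j hj⟩
  have hinj : Function.Injective Ψ := by
    intro K K' h
    have hW : ∀ (K K' : QFX R), Ψ K = Ψ K' → qfW K.1 ≤ qfW K'.1 := by
      intro K K' h x hx
      have := K'.2.1
      have h' : qfL (qfW K.1 : Set R) = qfL (qfW K'.1 : Set R) := congrArg Subtype.val h
      refine qf_rl hR (qfW K'.1 : Set R) (qfW K'.1).zero_mem
        (fun x hx y hy => (qfW K'.1).add_mem hx hy) (fun x hx r => qfW_mul_mem _ x hx r) x ?_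
      intro a ha
      rw [← h'] at ha
      exact ha x hx
    have heq : qfW K.1 = qfW K'.1 := le_antisymm (hW _ _ h) (hW _ _ h.symm)
    apply Subtype.ext
    ext y
    rw [qf_recover hR, qf_recover hR, heq]
  have := qfX_finite (R := R)
  obtain ⟨K, hK⟩ := Finite.surjective_of_injective hinj ⟨I, hI, hJ⟩
  have hK' : qfL (qfW K.1 : Set R) = I := congrArg Subtype.val hK
  by_contra! hno
  apply htop
  rw [Ideal.eq_top_iff_one, ← hK']
  intro w hw
  by_contra hw0
  rw [one_mul] at hw0
  obtain ⟨a, ha, haw⟩ := hno w hw0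
  rw [← hK'] at ha
  exact haw (ha w hw)

theorem qf_simple_submodule [IsArtinianRing R] {M : Type u} [AddCommGroup M] [Module R M]
    (x : M) (hx : x ≠ 0) : ∃ U : Submodule R M, U ≤ Submodule.span R {x} ∧ IsSimpleModule R U := by
  have hne : Nontrivial (Submodule.span R {x}) := by
    rw [Submodule.nontrivial_iff_ne_bot]
    simpa using hx
  obtain ⟨V, hV⟩ := IsAtomic.exists_atom (Submodule R (Submodule.span R {x}))
  have := isSimpleModule_iff_isAtom.mpr hV
  refine ⟨V.map (Submodule.subtype _), Submodule.map_subtype_le _ _, ?_⟩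
  exact IsSimpleModule.congr
    (Submodule.equivMapOfInjective _ (Submodule.injective_subtype _) V).symm

theorem qf_quot_semisimple [IsSemiprimaryRing R] (M : Type u) [AddCommGroup M] [Module R M]
    (h : Ring.jacobson R ≤ Module.annihilator R M) : IsSemisimpleModule R M := by
  rw [← SetLike.coe_subset_coe, ← Module.isTorsionBySet_iff_subset_annihilator] at h
  let _ := h.module
  exact (h.semilinearMap.isSemisimpleModule_iff_of_bijective Function.bijective_id).2
      inferInstance

theorem qf_kasch [IsNoetherianRing R] [IsArtinianRing R] [IsSemiprimaryRing R]
    (hR : Module.Injective R R) (S : Type u) [AddCommGroup S] [Module R S]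
    [IsSimpleModule R S] : ∃ f : S →ₗ[R] R, Function.Injective f := by
  let I := Module.annihilator R S
  have hIJ : Ring.jacobson R ≤ I := IsSemisimpleModule.jacobson_le_annihilator R S
  have hntS := IsSimpleModule.nontrivial R S
  have htop : I ≠ ⊤ := by
    intro h
    obtain ⟨s, hs⟩ := exists_ne (0 : S)
    apply hs
    have : (1 : R) ∈ I := by rw [h]; trivial
    simpa using Module.mem_annihilator.mp this s
  have hI2 : I.IsTwoSided := inferInstanceAs (Module.annihilator R S).IsTwoSided
  obtain ⟨w, hw0, hw⟩ := qf_two_sided_ann hR I hI2 hIJ htop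
  obtain ⟨U, hU, hUs⟩ := qf_simple_submodule (R := R) w hw0
  have hntU := IsSimpleModule.nontrivial R U
  obtain ⟨u, hu⟩ := exists_ne (0 : U)
  have hIU : ∀ a ∈ I, a • u = 0 := by
    intro a ha
    obtain ⟨c, hc⟩ := Submodule.mem_span_singleton.mp (hU u.2)
    apply Subtype.ext
    simp only [Submodule.coe_smul, ← hc, smul_eq_mul, Submodule.coe_zero]
    rw [← mul_assoc]
    exact hw _ (Ideal.mul_mem_right _ _ ha)
  have hss : IsSemisimpleModule R (R ⧸ I) := by
    apply qf_quot_semisimple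
    intro j hj
    rw [Module.mem_annihilator]
    intro x
    obtain ⟨x, rfl⟩ := Submodule.Quotient.mk_surjective I x
    rw [← Submodule.Quotient.mk_smul, Submodule.Quotient.mk_eq_zero, smul_eq_mul]
    exact Ideal.mul_mem_right _ _ (hIJ hj)
  let π : (R ⧸ I) →ₗ[R] U := I.liftQ (LinearMap.toSpanSingleton R U u) (fun a ha => hIU a ha)
  have hπ : Function.Surjective π := by
    intro v
    obtain ⟨r, hr⟩ := IsSimpleModule.toSpanSingleton_surjective R hu v
    exact ⟨Submodule.Quotient.mk r, hr⟩
  obtain ⟨σ, hσ⟩ := IsSemisimpleModule.lifting_property π hπ (LinearMap.id : U →ₗ[R] U)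
  have hσu : σ u ≠ 0 := by
    intro h
    apply hu
    have := LinearMap.congr_fun hσ u
    simpa [h] using this.symm
  obtain ⟨r, hr⟩ := Submodule.Quotient.mk_surjective I (σ u)
  have hrI : r ∉ I := by
    intro h
    apply hσu
    rw [← hr]
    exact (Submodule.Quotient.mk_eq_zero I).mpr h
  have hrs : ∃ s : S, r • s ≠ 0 := by
    by_contra! h
    exact hrI (Module.mem_annihilator.mpr h)
  obtain ⟨s, hs⟩ := hrs
  let τ : (R ⧸ I) →ₗ[R] S := I.liftQ (LinearMap.toSpanSingleton R S s)
    (fun a ha => Module.mem_annihilator.mp ha s)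
  have hne : τ ∘ₗ σ ≠ 0 := by
    intro h
    apply hs
    have := LinearMap.congr_fun h u
    rw [LinearMap.comp_apply, ← hr] at this
    exact this
  have hbij := LinearMap.bijective_of_ne_zero hne
  let e := LinearEquiv.ofBijective _ hbij
  exact ⟨U.subtype ∘ₗ e.symm.toLinearMap, U.injective_subtype.comp e.symm.injective⟩

theorem qf_embed [IsNoetherianRing R] (hR : Module.Injective R R)
    (M : Type u) [AddCommGroup M] [Module R M] :
    ∃ (ι : Type u) (f : M →ₗ[R] (ι →₀ R)), Function.Injective f := by
  classical
  have := qf_semiprimary hR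
  have : IsArtinianRing R := IsSemiprimaryRing.isNoetherian_iff_isArtinian.mp
    (inferInstance : IsNoetherian R R)
  let N : Submodule R M := sSup {m | IsSimpleModule R m}
  have hN : IsSemisimpleModule R N := by
    have := isSemisimpleModule_biSup_of_isSemisimpleModule_submodule
      (s := {m : Submodule R M | IsSimpleModule R m}) (p := id) (fun m hm => by
        have : IsSimpleModule R m := hm
        exact (inferInstance : IsSemisimpleModule R m))
    have hNe : N = ⨆ m ∈ {m : Submodule R M | IsSimpleModule R m}, id m := sSup_eq_iSup
    exact IsSemisimpleModule.congr (LinearEquiv.ofEq _ _ hNe)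
  obtain ⟨s, e, -, hs⟩ := IsSemisimpleModule.exists_linearEquiv_dfinsupp (R := R) (M := N)
  choose f hf using fun m : s => (have := hs m; qf_kasch hR (R := R) m.1)
  let φ : N →ₗ[R] (s →₀ R) := (finsuppLequivDFinsupp R).symm.toLinearMap ∘ₗ
    DFinsupp.mapRange.linearMap f ∘ₗ e.toLinearMap
  have hφ : Function.Injective φ := by
    have h1 : Function.Injective (DFinsupp.mapRange.linearMap f) :=
      (DFinsupp.mapRange_injective _ (fun i => map_zero (f i))).mpr hf
    exact (finsuppLequivDFinsupp R).symm.injective.comp (h1.comp e.injective)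
  obtain ⟨g, hg⟩ := (qf_finsupp_injective hR s).out N.subtype N.injective_subtype φ
  refine ⟨s, g, ?_⟩
  rw [← LinearMap.ker_eq_bot, Submodule.eq_bot_iff]
  intro x hx
  by_contra hx0
  obtain ⟨U, hU, hUs⟩ := qf_simple_submodule (R := R) x hx0
  have hntU := IsSimpleModule.nontrivial R U
  obtain ⟨u, hu⟩ := exists_ne (0 : U)
  have huN : (u : M) ∈ N := (le_sSup hUs : U ≤ N) u.2
  have hgu : g u = 0 := by
    have : Submodule.span R {x} ≤ LinearMap.ker g := by
      rw [Submodule.span_singleton_le_iff_mem]; exact hx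
    exact this (hU u.2)
  have h1 := hg ⟨u, huN⟩
  rw [Submodule.subtype_apply, hgu] at h1
  have h2 := hφ (h1.symm.trans (map_zero φ).symm)
  apply hu
  apply Subtype.ext
  have h3 : (u : M) = ((0 : N) : M) := congrArg (fun y : N => (y : M)) h2
  simpa using h3

end QFaux

/-- Over a quasi-Frobenius ring (a Noetherian ring that is injective as a module over itself),
every module is both si.e.r. and sp.e.r. -/
theorem qf_isSIER_and_isSPER (R : Type u) [Ring R] [IsNoetherianRing R]
    (hR : Module.Injective R R) :
    ∀ (M : Type u) [AddCommGroup M] [Module R M], IsSIER R M ∧ IsSPER R M := by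
  intro M _ _
  constructor
  · intro A B C _ _ _ _ _ _ α β hα hβ hex hA hC C' _ _ i hi f
    obtain ⟨ι, j, hj⟩ := qf_embed hR M
    have hF := qf_finsupp_injective hR ι
    obtain ⟨h, hh⟩ := hC _ j hj (β ∘ₗ f)
    obtain ⟨h', hh'⟩ := Module.projective_lifting_property β h hβ
    have hd : ∀ m, ∃ a, α a = f m - h' (j m) := by
      intro m
      refine (hex _).mp ?_
      have h1 := LinearMap.congr_fun hh m
      have h2 := LinearMap.congr_fun hh' (j m)
      simp only [LinearMap.coe_comp, Function.comp_apply] at h1 h2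
      rw [map_sub, h2, h1, sub_self]
    let a : M →ₗ[R] A := (LinearEquiv.ofInjective α hα).symm.toLinearMap ∘ₗ
      LinearMap.codRestrict (LinearMap.range α) (f - h' ∘ₗ j) (fun m => hd m)
    have ha : ∀ m, α (a m) = f m - h' (j m) := by
      intro m
      have := LinearEquiv.ofInjective_symm_apply (f := α) (h := hα)
        (LinearMap.codRestrict (LinearMap.range α) (f - h' ∘ₗ j) (fun m => hd m) m)
      exact this
    obtain ⟨a', ha'⟩ := hA _ j hj a
    obtain ⟨l, hl⟩ := hF.out i hi j
    refine ⟨(h' + α ∘ₗ a') ∘ₗ l, ?_⟩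
    ext m
    have h3 := LinearMap.congr_fun ha' m
    simp only [LinearMap.coe_comp, Function.comp_apply] at h3
    simp [hl, h3, ha]
  · intro A B C _ _ _ _ _ _ α β hα hβ hex hA hC C' _ _ p hp f
    let q : (M →₀ R) →ₗ[R] M := Finsupp.linearCombination R id
    have hq : Function.Surjective q := Finsupp.linearCombination_id_surjective R M
    have hF := qf_finsupp_injective hR M
    obtain ⟨a, ha⟩ := hA _ q hq (f ∘ₗ α)
    obtain ⟨b, hb⟩ := hF.out α hα a
    have hker : LinearMap.ker β ≤ LinearMap.ker (f - q ∘ₗ b) := by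
      intro x hx
      obtain ⟨y, rfl⟩ := (hex x).mp hx
      have h1 := LinearMap.congr_fun ha y
      simp only [LinearMap.coe_comp, Function.comp_apply] at h1
      simp [hb, h1]
    let c : C →ₗ[R] M := (LinearMap.ker β).liftQ (f - q ∘ₗ b) hker ∘ₗ
      (β.quotKerEquivOfSurjective hβ).symm.toLinearMap
    have hc : ∀ x, c (β x) = f x - q (b x) := by
      intro x
      have : (β.quotKerEquivOfSurjective hβ).symm (β x) = Submodule.Quotient.mk x := by
        rw [LinearEquiv.symm_apply_eq]; rfl
      simp [c, this]
    obtain ⟨d, hd⟩ := hC _ q hq c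
    obtain ⟨l, hl⟩ := Module.projective_lifting_property p q hp
    refine ⟨l ∘ₗ (b + d ∘ₗ β), ?_⟩
    ext x
    have h1 := fun y => LinearMap.congr_fun hl y
    have h2 := fun y => LinearMap.congr_fun hd y
    simp only [LinearMap.coe_comp, Function.comp_apply] at h1 h2
    simp [h1, h2, hc]
end
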